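/- arXiv:1804.03616 — 2 statements merged into one kernel-verified Lean document; each statement's English description precedes it below -/
import Mathlib

section
/- Let H_k be a random variable Poisson distributed with parameter n ∫_{B_k} λ0(x) dx, and set ψ̂_k = (H_k + α)/(nΔ + β). Then the bias of ψ̂_k at the left endpoint b_{k−1} of B_k satisfies | E[ψ̂_k] − λ0(b_{k−1}) | ≤ L Δ^h + (α + β · sup_{[0,T]} λ0)/(nΔ + β). -/
open MeasureTheory ProbabilityTheory Real

/-- The uniform bins on `[0,T]`: for `k = 0,…,N-1` (0-indexed), the `k`-th bin is
`[Tk/N, T(k+1)/N)`, except the last one, which is `[T(N-1)/N, T]`. -/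
noncomputable def unifBin (T : ℝ) (N : ℕ) (k : Fin N) : Set ℝ :=
  if k.val = N - 1 then Set.Icc (T * k.val / N) T
  else Set.Ico (T * k.val / N) (T * (k.val + 1) / N)

lemma hasSum_mean_poissonMeasure (r : NNReal) :
    HasSum (fun n : ℕ ↦ exp (-(r : ℝ)) * (r : ℝ) ^ n / (n.factorial : ℝ) * (n : ℝ)) r := by
  rw [← hasSum_nat_add_iff' 1]
  simp only [Finset.sum_range_one, Nat.cast_zero, mul_zero, sub_zero]
  convert! (hasSum_one_poissonMeasure r).mul_left (r : ℝ) using 1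
  · ext n
    have hn : (n.factorial : ℝ) ≠ 0 := by positivity
    have hn' : (n : ℝ) + 1 ≠ 0 := by positivity
    rw [Nat.factorial_succ]
    push_cast
    field_simp
    ring
  · simp

lemma integrable_natCast_poissonMeasure (r : NNReal) :
    Integrable (fun n : ℕ ↦ (n : ℝ)) (poissonMeasure r) := by
  rw [integrable_poissonMeasure_iff]
  simpa using (hasSum_mean_poissonMeasure r).summable

lemma integral_natCast_poissonMeasure (r : NNReal) :
    ∫ n : ℕ, (n : ℝ) ∂(poissonMeasure r) = r := by
  rw [integral_poissonMeasure]
  simpa using (hasSum_mean_poissonMeasure r).tsum_eq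

lemma integral_add_div_of_map_eq_poissonMeasure {Ω : Type*} [MeasurableSpace Ω] {P : Measure Ω}
    [IsProbabilityMeasure P] {H : Ω → ℕ} (hmeas : Measurable H) {r : NNReal}
    (hdist : P.map H = poissonMeasure r) (a c : ℝ) :
    ∫ ω, ((H ω : ℝ) + a) / c ∂P = (r + a) / c := by
  have hint : Integrable (fun ω ↦ (H ω : ℝ)) P := by
    have hmap := integrable_natCast_poissonMeasure r
    rw [← hdist] at hmap
    exact hmap.comp_measurable hmeas
  have hmean : ∫ ω, (H ω : ℝ) ∂P = r := by
    rw [← integral_natCast_poissonMeasure r, ← hdist, integral_map hmeas.aemeasurable .of_discrete]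
  rw [integral_div, integral_add hint (integrable_const a), hmean]
  simp

lemma continuousOn_of_abs_sub_le_rpow {f : ℝ → ℝ} {s : Set ℝ} {L h : ℝ} (hh : 0 < h)
    (hf : ∀ x ∈ s, ∀ y ∈ s, |f x - f y| ≤ L * |x - y| ^ h) : ContinuousOn f s := by
  intro x hx
  rw [ContinuousWithinAt, tendsto_iff_norm_sub_tendsto_zero]
  refine squeeze_zero' (.of_forall fun _ ↦ norm_nonneg _)
    (eventually_nhdsWithin_of_forall fun y hy ↦ hf y hy x hx) ?_
  have hcont : Continuous fun y : ℝ ↦ L * |y - x| ^ h :=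
    continuous_const.mul ((continuous_id.sub continuous_const).abs.rpow_const
      fun _ ↦ Or.inr hh.le)
  simpa [hh.ne'] using (hcont.tendsto x).mono_left nhdsWithin_le_nhds

lemma unifBin_subset_Icc {T : ℝ} {N : ℕ} (hN : 0 < N) (k : Fin N) :
    unifBin T N k ⊆ Set.Icc (T * k.val / N) (T * k.val / N + T / N) := by
  have hN' : (N : ℝ) ≠ 0 := by positivity
  unfold unifBin
  split_ifs with hk
  · have hk' : ((k.val : ℕ) : ℝ) = N - 1 := by
      rw [hk, Nat.cast_sub hN, Nat.cast_one]
    refine Set.Icc_subset_Icc_right (le_of_eq ?_)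
    rw [hk']
    field_simp
    ring
  · refine Set.Ico_subset_Icc_self.trans (Set.Icc_subset_Icc_right (le_of_eq ?_))
    ring

lemma measurableSet_unifBin (T : ℝ) (N : ℕ) (k : Fin N) : MeasurableSet (unifBin T N k) := by
  unfold unifBin
  split_ifs
  exacts [measurableSet_Icc, measurableSet_Ico]

lemma volume_real_unifBin {T : ℝ} (hT : 0 ≤ T) {N : ℕ} (hN : 0 < N) (k : Fin N) :
    volume.real (unifBin T N k) = T / N := by
  have hN' : (0 : ℝ) < N := by positivity
  unfold unifBin
  split_ifs with hk
  · have hk' : ((k.val : ℕ) : ℝ) = N - 1 := by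
      rw [hk, Nat.cast_sub hN, Nat.cast_one]
    have hlen : T - T * k.val / N = T / N := by
      rw [hk']
      field_simp
      ring
    have hnonneg : 0 ≤ T / N := by positivity
    rw [volume_real_Icc_of_le (by linarith), hlen]
  · have hlen : T * (k.val + 1) / N - T * k.val / N = T / N := by ring
    have hnonneg : 0 ≤ T / N := by positivity
    rw [volume_real_Ico_of_le (by linarith), hlen]

/-- Bias bound for the posterior mean coefficient `ψ̂ₖ = (Hₖ+α)/(nΔ+β)`, where `Hₖ` is
Poisson with parameter `n∫_{Bₖ}λ₀`:
`|E[ψ̂ₖ] - λ₀(b_{k-1})| ≤ L Δ^h + (α + β sup_{[0,T]} λ₀)/(nΔ+β)`. -/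
theorem posterior_mean_bias_bound
    (T L h : ℝ) (hT : 0 < T) (hL : 0 < L) (hh : 0 < h) (hh1 : h ≤ 1)
    (lam0 : ℝ → ℝ) (hpos : ∀ x ∈ Set.Icc 0 T, 0 < lam0 x)
    (hHolder : ∀ x ∈ Set.Icc 0 T, ∀ y ∈ Set.Icc 0 T, |lam0 x - lam0 y| ≤ L * |x - y| ^ h)
    (α β : ℝ) (hα : 0 < α) (hβ : 0 < β) (n : ℕ) (hn : 0 < n)
    (N : ℕ) (hN : 0 < N) (k : Fin N)
    (Ω : Type) (mΩ : MeasurableSpace Ω) (P : Measure Ω) (hP : IsProbabilityMeasure P)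
    (H : Ω → ℕ) (hmeas : Measurable H)
    (hdist : P.map H = poissonMeasure (Real.toNNReal (n * ∫ x in unifBin T N k, lam0 x))) :
    |(∫ ω, ((H ω : ℝ) + α) / (n * (T / N) + β) ∂P) - lam0 (T * k.val / N)|
      ≤ L * (T / N) ^ h
        + (α + β * sSup (lam0 '' Set.Icc 0 T)) / (n * (T / N) + β) := by
  have hN' : (0 : ℝ) < N := by positivity
  have hn' : (0 : ℝ) < n := by positivity
  have hcont : ContinuousOn lam0 (Set.Icc 0 T) := continuousOn_of_abs_sub_le_rpow hh hHolder
  set b : ℝ := T * k.val / N with hb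
  set Δ : ℝ := T / N with hΔ
  have hΔpos : 0 < Δ := by positivity
  have hb0 : 0 ≤ b := by positivity
  have hbT : b + Δ ≤ T := by
    have hk : (k.val : ℝ) + 1 ≤ N := by exact_mod_cast k.isLt
    have hsum : b + Δ = T * (k.val + 1) / N := by rw [hb, hΔ]; ring
    rw [hsum, div_le_iff₀ hN']
    gcongr
  have hbmem : b ∈ Set.Icc 0 T := ⟨hb0, by linarith⟩
  have hbin : unifBin T N k ⊆ Set.Icc b (b + Δ) := unifBin_subset_Icc hN k
  have hsub : unifBin T N k ⊆ Set.Icc 0 T := hbin.trans (Set.Icc_subset_Icc hb0 hbT)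
  have hvol : volume.real (unifBin T N k) = Δ := volume_real_unifBin hT.le hN k
  have hfin : volume (unifBin T N k) < ⊤ := (measure_mono hsub).trans_lt measure_Icc_lt_top
  have hint : IntegrableOn lam0 (unifBin T N k) :=
    (hcont.integrableOn_compact isCompact_Icc).mono_set hsub
  have hnonneg : 0 ≤ ∫ x in unifBin T N k, lam0 x :=
    setIntegral_nonneg (measurableSet_unifBin T N k) fun x hx ↦ (hpos x (hsub hx)).le
  have hosc : |(∫ x in unifBin T N k, lam0 x) - Δ * lam0 b| ≤ L * Δ ^ h * Δ := by
    have hbound : ∀ x ∈ unifBin T N k, ‖lam0 x - lam0 b‖ ≤ L * Δ ^ h := fun x hx ↦ by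
      refine (hHolder x (hsub hx) b hbmem).trans ?_
      have hx' := hbin hx
      rw [abs_of_nonneg (by linarith [hx'.1])]
      have hxb : 0 ≤ x - b := by linarith [hx'.1]
      have hxΔ : x - b ≤ Δ := by linarith [hx'.2]
      gcongr
    have hle := norm_setIntegral_le_of_norm_le_const hfin hbound
    rwa [integral_sub hint (integrableOn_const hfin.ne), setIntegral_const, hvol, smul_eq_mul,
      norm_eq_abs] at hle
  have hsup : lam0 b ≤ sSup (lam0 '' Set.Icc 0 T) :=
    le_csSup (isCompact_Icc.bddAbove_image hcont) ⟨b, hbmem, rfl⟩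
  rw [integral_add_div_of_map_eq_poissonMeasure hmeas hdist, coe_toNNReal _ (by positivity)]
  set I := ∫ x in unifBin T N k, lam0 x
  have hc : 0 < n * Δ + β := by positivity
  have hsplit : (n * I + α) / (n * Δ + β) - lam0 b
      = (n * (I - Δ * lam0 b) + (α - β * lam0 b)) / (n * Δ + β) := by
    field_simp
    ring
  have hshrink : |α - β * lam0 b| ≤ α + β * sSup (lam0 '' Set.Icc 0 T) := by
    have hlb := mul_pos hβ (hpos b hbmem)
    have hlsup := mul_le_mul_of_nonneg_left hsup hβ.le
    rw [abs_le]
    constructor <;> linarith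
  have hscaled : |n * (I - Δ * lam0 b)| ≤ L * Δ ^ h * (n * Δ + β) := by
    rw [abs_mul, abs_of_pos hn']
    have hmul := mul_le_mul_of_nonneg_left hosc hn'.le
    have hrest : 0 ≤ L * Δ ^ h * β := by positivity
    linarith
  rw [hsplit, abs_div, abs_of_pos hc, div_le_iff₀ hc, add_mul, div_mul_cancel₀ _ hc.ne']
  exact (abs_add_le _ _).trans (add_le_add hscaled hshrink)
end

section
/- Let α > 0, let N and n be positive integers, let Δ_1,…,Δ_N > 0 and let H_1,…,H_N be natural numbers with Σ_{k=1}^N H_k > 0. Then the equation α/β = (1/N) Σ_{k=1}^N (H_k + α)/(nΔ_k + β) has a unique solution β* ∈ (0,∞), and β* is the unique global maximizer over (0,∞) of the function g(β) = Nα log β − Σ_{k=1}^N (α + H_k) log(nΔ_k + β), which equals the logarithm of the marginal likelihood β ↦ e^{Tn} (β^{αN}/Γ(α)^N) ∏_{k=1}^N Γ(α+H_k)/(nΔ_k+β)^{α+H_k} up to an additive term not depending on β. -/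
open MeasureTheory Real

/-- A positive combination of the saturation curves `x ↦ x / (d k + x)` is strictly increasing
on `[0, ∞)`. -/
lemma strictMonoOn_sum_mul_div_add {ι : Type*} [Fintype ι] [Nonempty ι] {a d : ι → ℝ}
    (ha : ∀ k, 0 < a k) (hd : ∀ k, 0 < d k) :
    StrictMonoOn (fun x : ℝ => ∑ k, a k * (x / (d k + x))) (Set.Ici 0) := by
  intro x hx y hy hxy
  simp only [Set.mem_Ici] at hx hy
  refine Finset.sum_lt_sum_of_nonempty Finset.univ_nonempty fun k _ => ?_
  have hdk := hd k
  refine mul_lt_mul_of_pos_left ?_ (ha k)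
  rw [div_lt_div_iff₀ (by positivity) (by positivity)]
  nlinarith

/-- A positive combination of saturation curves attains every level strictly between `0` and the
total weight. -/
lemma exists_pos_sum_mul_div_add_eq {ι : Type*} [Fintype ι] [Nonempty ι] {a d : ι → ℝ} {C : ℝ}
    (ha : ∀ k, 0 < a k) (hd : ∀ k, 0 < d k) (hC : 0 < C) (hCa : C < ∑ k, a k) :
    ∃ b : ℝ, 0 < b ∧ ∑ k, a k * (b / (d k + b)) = C := by
  have hS : 0 < ∑ k, a k * d k :=
    Finset.sum_pos (fun k _ => mul_pos (ha k) (hd k)) Finset.univ_nonempty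
  set S := ∑ k, a k * d k with hSdef
  set M := S / (∑ k, a k - C) with hM
  have hgap : 0 < ∑ k, a k - C := sub_pos.2 hCa
  have hM0 : 0 < M := div_pos hS hgap
  have hcont : ContinuousOn (fun x : ℝ => ∑ k, a k * (x / (d k + x))) (Set.Icc 0 M) := by
    refine continuousOn_finsetSum _ fun k _ => continuousOn_const.mul
      (continuousOn_id.div (continuousOn_const.add continuousOn_id) fun x hx => ?_)
    exact (add_pos_of_pos_of_nonneg (hd k) hx.1).ne'
  have hlarge : C ≤ ∑ k, a k * (M / (d k + M)) := by
    have hterm : ∀ k, a k - a k * d k / M ≤ a k * (M / (d k + M)) := fun k => by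
      have hdk := hd k
      have hsplit : a k * (M / (d k + M)) = a k - a k * d k / (d k + M) := by
        field_simp
        ring
      rw [hsplit]
      have hak := ha k
      gcongr
      linarith
    calc C = ∑ k, a k - S / M := by rw [hM]; field_simp; ring
      _ = ∑ k, (a k - a k * d k / M) := by
        rw [Finset.sum_sub_distrib, hSdef, Finset.sum_div]
      _ ≤ _ := Finset.sum_le_sum fun k _ => hterm k
  obtain ⟨b, hb, hbC⟩ := intermediate_value_Icc hM0.le hcont ⟨by simpa using hC.le, hlarge⟩
  refine ⟨b, lt_of_le_of_ne hb.1 ?_, hbC⟩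
  rintro rfl
  simp at hbC
  exact hC.ne hbC

lemma hasDerivAt_mul_log_sub_sum_mul_log_add {ι : Type*} [Fintype ι] {a d : ι → ℝ} (C : ℝ)
    (hd : ∀ k, 0 < d k) {x : ℝ} (hx : 0 < x) :
    HasDerivAt (fun x => C * log x - ∑ k, a k * log (d k + x))
      ((C - ∑ k, a k * (x / (d k + x))) / x) x := by
  have hsum : HasDerivAt (fun x => ∑ k, a k * log (d k + x)) (∑ k, a k * (1 / (d k + x))) x := by
    refine HasDerivAt.fun_sum fun k _ => HasDerivAt.const_mul _ ?_
    exact ((hasDerivAt_id x).const_add (d k)).log (add_pos (hd k) hx).ne'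
  refine (((hasDerivAt_log hx.ne').const_mul C).fun_sub hsum).congr_deriv ?_
  rw [sub_div, Finset.sum_div, div_eq_mul_inv]
  congr 1
  refine Finset.sum_congr rfl fun k _ => ?_
  have hdk := hd k
  field_simp

/-- A critical point of `x ↦ C log x - ∑ a k log (d k + x)` is its unique maximizer on `(0, ∞)`. -/
lemma mul_log_sub_sum_mul_log_add_lt {ι : Type*} [Fintype ι] [Nonempty ι] {a d : ι → ℝ} {C b x : ℝ}
    (ha : ∀ k, 0 < a k) (hd : ∀ k, 0 < d k) (hb : 0 < b)
    (hbC : ∑ k, a k * (b / (d k + b)) = C) (hx : 0 < x) (hxb : x ≠ b) :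
    C * log x - ∑ k, a k * log (d k + x) < C * log b - ∑ k, a k * log (d k + b) := by
  have hmono := strictMonoOn_sum_mul_div_add ha hd
  have hderiv {y : ℝ} (hy : 0 < y) := hasDerivAt_mul_log_sub_sum_mul_log_add (a := a) C hd hy
  rcases hxb.lt_or_gt with h | h
  · refine strictMonoOn_of_deriv_pos (convex_Icc x b) (fun y hy =>
      (hderiv (hx.trans_le hy.1)).continuousAt.continuousWithinAt) (fun y hy => ?_)
      (Set.left_mem_Icc.2 h.le) (Set.right_mem_Icc.2 h.le) h
    rw [interior_Icc] at hy
    have hy0 : 0 < y := hx.trans hy.1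
    rw [(hderiv hy0).deriv]
    exact div_pos (sub_pos.2 (hbC ▸ hmono hy0.le hb.le hy.2)) hy0
  · refine strictAntiOn_of_deriv_neg (convex_Icc b x) (fun y hy =>
      (hderiv (hb.trans_le hy.1)).continuousAt.continuousWithinAt) (fun y hy => ?_)
      (Set.left_mem_Icc.2 h.le) (Set.right_mem_Icc.2 h.le) h
    rw [interior_Icc] at hy
    have hy0 : 0 < y := hb.trans hy.1
    rw [(hderiv hy0).deriv]
    exact div_neg_of_neg_of_pos (sub_neg.2 (hbC ▸ hmono hb.le hy0.le hy.1)) hy0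

/-- Empirical Bayes choice of the rate hyperparameter `β`: the fixed-point equation
`α/β = (1/N) Σₖ (Hₖ+α)/(nΔₖ+β)` has a unique solution `β* ∈ (0,∞)`, which is the unique
global maximizer of `g(β) = Nα log β − Σₖ (α+Hₖ) log(nΔₖ+β)`, and `g` equals the log
marginal likelihood up to an additive constant not depending on `β`. -/
theorem empirical_bayes_beta_unique
    (α : ℝ) (hα : 0 < α) (N n : ℕ) (hN : 0 < N) (hn : 0 < n)
    (Δ : Fin N → ℝ) (hΔ : ∀ k, 0 < Δ k) (H : Fin N → ℕ) (hH : 0 < ∑ k, H k)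
    (T : ℝ) :
    ∃ b : ℝ, 0 < b ∧
      α / b = (1 / N) * ∑ k, ((H k : ℝ) + α) / (n * Δ k + b) ∧
      (∀ b' : ℝ, 0 < b' →
        α / b' = (1 / N) * ∑ k, ((H k : ℝ) + α) / (n * Δ k + b') → b' = b) ∧
      (∀ b' : ℝ, 0 < b' → b' ≠ b →
        N * α * Real.log b' - ∑ k, (α + (H k : ℝ)) * Real.log (n * Δ k + b')
          < N * α * Real.log b - ∑ k, (α + (H k : ℝ)) * Real.log (n * Δ k + b)) ∧
      ∃ c : ℝ, ∀ b' : ℝ, 0 < b' →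
        Real.log (Real.exp (T * n) * (b' ^ (α * N) / Real.Gamma α ^ N) *
            ∏ k, Real.Gamma (α + H k) / (n * Δ k + b') ^ (α + (H k : ℝ)))
          = (N * α * Real.log b'
              - ∑ k, (α + (H k : ℝ)) * Real.log (n * Δ k + b')) + c := by
  have : Nonempty (Fin N) := ⟨⟨0, hN⟩⟩
  have hN' : (0 : ℝ) < N := Nat.cast_pos.2 hN
  have hn' : (0 : ℝ) < n := Nat.cast_pos.2 hn
  have hd : ∀ k, 0 < n * Δ k := fun k => mul_pos hn' (hΔ k)
  have ha : ∀ k, 0 < α + (H k : ℝ) := fun k => by positivity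
  have hlt : N * α < ∑ k, (α + (H k : ℝ)) := by
    have hH' : (0 : ℝ) < ∑ k, (H k : ℝ) := by exact_mod_cast hH
    simpa [Finset.sum_add_distrib] using hH'
  have hiff : ∀ x : ℝ, 0 < x →
      (α / x = (1 / N) * ∑ k, ((H k : ℝ) + α) / (n * Δ k + x) ↔
        ∑ k, (α + (H k : ℝ)) * (x / (n * Δ k + x)) = N * α) := fun x hx => by
    have hsum : ∑ k, (α + (H k : ℝ)) * (x / (n * Δ k + x))
        = x * ∑ k, ((H k : ℝ) + α) / (n * Δ k + x) := by
      rw [Finset.mul_sum]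
      exact Finset.sum_congr rfl fun k _ => by ring
    rw [hsum, div_eq_iff hx.ne', eq_comm, one_div, mul_assoc, inv_mul_eq_iff_eq_mul₀ hN'.ne',
      mul_comm x]
  obtain ⟨b, hb, hbC⟩ := exists_pos_sum_mul_div_add_eq ha hd (by positivity) hlt
  refine ⟨b, hb, (hiff b hb).2 hbC, fun x hx hxeq => ?_, fun x hx hxb =>
    mul_log_sub_sum_mul_log_add_lt ha hd hb hbC hx hxb,
    T * n - N * log (Gamma α) + ∑ k, log (Gamma (α + H k)), fun x hx => ?_⟩
  · exact (strictMonoOn_sum_mul_div_add ha hd).injOn hx.le hb.le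
      (((hiff x hx).1 hxeq).trans hbC.symm)
  · have hΓ : 0 < Gamma α := Gamma_pos_of_pos hα
    have hΓk : ∀ k, 0 < Gamma (α + H k) := fun k => Gamma_pos_of_pos (ha k)
    have hpow : ∀ k, 0 < (n * Δ k + x) ^ (α + (H k : ℝ)) := fun k =>
      rpow_pos_of_pos (add_pos (hd k) hx) _
    have hx' : 0 < x ^ (α * N) := rpow_pos_of_pos hx _
    have hprod : log (∏ k, Gamma (α + H k) / (n * Δ k + x) ^ (α + (H k : ℝ)))
        = ∑ k, log (Gamma (α + H k)) - ∑ k, (α + (H k : ℝ)) * log (n * Δ k + x) := by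
      rw [log_prod fun k _ => (div_pos (hΓk k) (hpow k)).ne', ← Finset.sum_sub_distrib]
      refine Finset.sum_congr rfl fun k _ => ?_
      rw [log_div (hΓk k).ne' (hpow k).ne', log_rpow (add_pos (hd k) hx)]
    rw [log_mul (by positivity) (Finset.prod_pos fun k _ => div_pos (hΓk k) (hpow k)).ne', hprod,
      log_mul (exp_pos _).ne' (by positivity), log_exp, log_div hx'.ne' (by positivity),
      log_rpow hx, log_pow]
    ring
end
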